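/- Let n ≥ 1, δ ≥ 0, let S ⊆ (ZMod 2)^n × (ZMod 2)^n be a finite nonempty δ-biased set (viewing pairs (a,b) as strings in (ZMod 2)^{2n}), and let E be the Ambainis–Smith cipher associated to S. Let t be a real number and ρ a density matrix on ℂ^{2^n} ⊗ ℂ^{d_E} such that there exists a density matrix σ on ℂ^{d_E} with ρ ≤ 2^{−t} (I_{2^n} ⊗ σ). Then ‖ E(ρ) − (I_{2^n}/2^n) ⊗ tr_A ρ ‖₁ ≤ δ · √(2^n · 2^{−t}). -/

import Mathlib

open Matrix Kronecker ComplexOrder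

noncomputable section

/-- A density matrix: positive semidefinite with trace 1. -/
def IsDensity {d : Type*} [Fintype d] (ρ : Matrix d d ℂ) : Prop :=
  ρ.PosSemidef ∧ ρ.trace = 1

/-- Loewner order: `A ≤ B` iff `B - A` is positive semidefinite. -/
def LoewnerLE {d : Type*} [Fintype d] (A B : Matrix d d ℂ) : Prop :=
  (B - A).PosSemidef

/-- Partial trace over the first (A) system. -/
def ptraceA {A E : Type*} [Fintype A] (M : Matrix (A × E) (A × E) ℂ) : Matrix E E ℂ :=
  Matrix.of fun e e' => ∑ a, M (a, e) (a, e')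

/-- Partial trace over the second (E) system. -/
def ptraceE {A E : Type*} [Fintype E] (M : Matrix (A × E) (A × E) ℂ) : Matrix A A ℂ :=
  Matrix.of fun a a' => ∑ e, M (a, e) (a', e)

/-- The positive semidefinite square root of a positive semidefinite matrix
(the definition of the older Mathlib, since removed there). -/
def Matrix.PosSemidef.sqrt {n 𝕜 : Type*} [Fintype n] [RCLike 𝕜] [DecidableEq n]
    {A : Matrix n n 𝕜} (hA : A.PosSemidef) : Matrix n n 𝕜 :=
  (hA.1.eigenvectorUnitary : Matrix n n 𝕜) *
    diagonal ((↑) ∘ Real.sqrt ∘ hA.1.eigenvalues) *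
    (star hA.1.eigenvectorUnitary : Matrix n n 𝕜)

/-- Trace norm of a complex matrix: `tr √(MᴴM)`. -/
def traceNorm {d : Type*} [Fintype d] [DecidableEq d] (M : Matrix d d ℂ) : ℝ :=
  ((Matrix.posSemidef_conjTranspose_mul_self M).sqrt).trace.re

/-- The n-qubit Pauli operator `X^u Z^v`, indexed by `(ZMod 2)^n`:
entry `(x, y)` is `(-1)^(v ⊙ y)` if `x = y + u` and `0` otherwise. -/
def pauliXZ (n : ℕ) (u v : Fin n → ZMod 2) :
    Matrix (Fin n → ZMod 2) (Fin n → ZMod 2) ℂ :=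
  Matrix.of fun x y => if x = y + u then (-1 : ℂ) ^ (∑ j, v j * y j).val else 0

/-- `(-1)^z` for `z ∈ ZMod 2`. -/
def signZ (z : ZMod 2) : ℝ := if z = 0 then 1 else -1

/-- A nonempty set `S ⊆ (ZMod 2)^n × (ZMod 2)^n` (viewed as strings of length `2n`)
is `δ`-biased if `|𝔼_{s∈S} (-1)^{s ⊙ s'}| ≤ δ` for every nonzero `s'`. -/
def DeltaBiased {n : ℕ} (δ : ℝ)
    (S : Finset ((Fin n → ZMod 2) × (Fin n → ZMod 2))) : Prop :=
  ∀ s' : (Fin n → ZMod 2) × (Fin n → ZMod 2), s' ≠ 0 →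
    |(S.card : ℝ)⁻¹ *
      ∑ s ∈ S, signZ ((∑ j, s.1 j * s'.1 j) + ∑ j, s.2 j * s'.2 j)| ≤ δ

/-- The Ambainis–Smith cipher associated to `S`:
`E(ρ) = (1/|S|) ∑_{(a,b)∈S} (X^a Z^b ⊗ I_E) ρ (X^a Z^b ⊗ I_E)†`. -/
def ASCipher {n : ℕ} {E : Type*} [Fintype E] [DecidableEq E]
    (S : Finset ((Fin n → ZMod 2) × (Fin n → ZMod 2)))
    (ρ : Matrix ((Fin n → ZMod 2) × E) ((Fin n → ZMod 2) × E) ℂ) :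
    Matrix ((Fin n → ZMod 2) × E) ((Fin n → ZMod 2) × E) ℂ :=
  (S.card : ℂ)⁻¹ • ∑ s ∈ S,
    (pauliXZ n s.1 s.2 ⊗ₖ (1 : Matrix E E ℂ)) * ρ *
      (pauliXZ n s.1 s.2 ⊗ₖ (1 : Matrix E E ℂ))ᴴ

def fro2 {a b : Type*} [Fintype a] [Fintype b] (X : Matrix a b ℂ) : ℝ := ∑ i, ∑ j, ‖X i j‖ ^ 2

lemma fro2_nonneg {a b : Type*} [Fintype a] [Fintype b] (X : Matrix a b ℂ) : 0 ≤ fro2 X := by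
  unfold fro2; positivity

lemma fro2_eq {a b : Type*} [Fintype a] [Fintype b] (X : Matrix a b ℂ) :
    ((Xᴴ * X).trace).re = fro2 X := by
  simp only [fro2, Matrix.trace, Matrix.diag, Matrix.mul_apply, Matrix.conjTranspose_apply,
    Complex.re_sum]
  rw [Finset.sum_comm]
  refine Finset.sum_congr rfl fun i _ => Finset.sum_congr rfl fun j _ => ?_
  rw [← Complex.normSq_eq_norm_sq, Complex.normSq_apply]
  simp

lemma fro2_eq' {a b : Type*} [Fintype a] [Fintype b] (X : Matrix a b ℂ) :
    ((X * Xᴴ).trace).re = fro2 X := by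
  rw [Matrix.trace_mul_comm, fro2_eq]

lemma tr_cs {a b : Type*} [Fintype a] [Fintype b] (X Y : Matrix a b ℂ) :
    ((Xᴴ * Y).trace).re ≤ √(fro2 X) * √(fro2 Y) := by
  have h1 : ((Xᴴ * Y).trace).re ≤ ∑ p : a × b, ‖X p.1 p.2‖ * ‖Y p.1 p.2‖ := by
    simp only [Matrix.trace, Matrix.diag, Matrix.mul_apply, Matrix.conjTranspose_apply,
      Complex.re_sum]
    rw [Finset.sum_comm, Fintype.sum_prod_type]
    refine Finset.sum_le_sum fun i _ => Finset.sum_le_sum fun j _ => ?_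
    refine (Complex.re_le_norm _).trans ?_
    simp
  refine h1.trans ?_
  have := Real.sum_mul_le_sqrt_mul_sqrt Finset.univ (fun p : a × b => ‖X p.1 p.2‖)
    (fun p : a × b => ‖Y p.1 p.2‖)
  simpa only [fro2, Fintype.sum_prod_type] using this

lemma traceNorm_dual {d : Type*} [Fintype d] [DecidableEq d] (M : Matrix d d ℂ) :
    ∃ C : Matrix d d ℂ, C * Cᴴ * C = C ∧ traceNorm M = ((Cᴴ * M).trace).re := by
  set hA := Matrix.posSemidef_conjTranspose_mul_self M with hAdef
  set V : Matrix d d ℂ := (hA.1.eigenvectorUnitary : Matrix d d ℂ) with hV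
  have hVV : Vᴴ * V = 1 := by
    have := Unitary.coe_star_mul_self hA.1.eigenvectorUnitary
    simpa [Matrix.star_eq_conjTranspose] using this
  set ev := hA.1.eigenvalues with hev
  have hev0 : ∀ i, 0 ≤ ev i := hA.eigenvalues_nonneg
  have hspec : Mᴴ * M = V * diagonal (fun i => (ev i : ℂ)) * Vᴴ := by
    have := hA.1.spectral_theorem
    rw [Unitary.conjStarAlgAut_apply] at this
    simpa [Matrix.star_eq_conjTranspose, Function.comp_def] using this
  set K : Matrix d d ℂ := diagonal (fun i => (((√(ev i))⁻¹ : ℝ) : ℂ)) with hK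
  have hKH : Kᴴ = K := by
    rw [hK, Matrix.diagonal_conjTranspose]; congr 1; ext i; simp
  have key : Vᴴ * (Mᴴ * M) * V = diagonal (fun i => (ev i : ℂ)) := by
    rw [hspec]
    calc _ = (Vᴴ * V) * diagonal (fun i => (ev i : ℂ)) * (Vᴴ * V) := by noncomm_ring
      _ = _ := by rw [hVV]; simp
  refine ⟨M * V * K * Vᴴ, ?_, ?_⟩
  · have e : (M * V * K * Vᴴ) * (M * V * K * Vᴴ)ᴴ * (M * V * K * Vᴴ)
      = M * V * (K * (Vᴴ * V) * K * (Vᴴ * (Mᴴ * M) * V) * K) * Vᴴ := by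
      simp only [Matrix.conjTranspose_mul, Matrix.conjTranspose_conjTranspose, hKH]
      noncomm_ring
    rw [e, key, hVV]
    have : K * 1 * K * diagonal (fun i => (ev i : ℂ)) * K = K := by
      rw [hK]; simp only [Matrix.mul_one, Matrix.diagonal_mul_diagonal]
      congr 1; ext i
      by_cases h : ev i = 0
      · simp [h]
      · have h2 : √(ev i) ≠ 0 := by
          rw [Real.sqrt_ne_zero (hev0 i)]; exact h
        have h3 : ((√(ev i) : ℝ) : ℂ) ≠ 0 := by exact_mod_cast h2
        have h4 : (ev i : ℂ) = ((√(ev i) : ℝ) : ℂ) * ((√(ev i) : ℝ) : ℂ) := by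
          exact_mod_cast (Real.mul_self_sqrt (hev0 i)).symm
        push_cast
        rw [h4]; field_simp
    rw [this]
  · have e : (M * V * K * Vᴴ)ᴴ * M = V * (K * (Vᴴ * (Mᴴ * M))) := by
      simp only [Matrix.conjTranspose_mul, Matrix.conjTranspose_conjTranspose, hKH]
      noncomm_ring
    have e2 : K * (Vᴴ * (Mᴴ * M)) * V = K * (Vᴴ * (Mᴴ * M) * V) := by noncomm_ring
    rw [e, Matrix.trace_mul_comm, e2, key]
    unfold traceNorm Matrix.PosSemidef.sqrt
    rw [Matrix.trace_mul_comm, ← Matrix.mul_assoc]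
    have hVV' : (star hA.1.eigenvectorUnitary : Matrix d d ℂ) *
      (hA.1.eigenvectorUnitary : Matrix d d ℂ) = 1 := by
      simpa [Matrix.star_eq_conjTranspose] using hVV
    rw [hVV', Matrix.one_mul, hK, Matrix.diagonal_mul_diagonal]
    congr 2
    congr 1; ext i
    simp only [Function.comp]
    have : √(ev i) = (√(ev i))⁻¹ * ev i := by
      by_cases h : ev i = 0
      · simp [h]
      · have h2 : √(ev i) ≠ 0 := by
          rw [Real.sqrt_ne_zero (hev0 i)]; exact h
        field_simp
        exact Real.sq_sqrt (hev0 i)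
    have h5 : ((√(ev i) : ℝ) : ℂ) = (((√(ev i))⁻¹ * ev i : ℝ) : ℂ) := by rw [← this]
    rw [Complex.ofReal_mul] at h5
    exact h5

lemma traceNorm_mul_le {d : Type*} [Fintype d] [DecidableEq d] (N B : Matrix d d ℂ) :
    traceNorm (N * B) ≤ √(fro2 N) * √(fro2 B) := by
  obtain ⟨C, hC, h⟩ := traceNorm_dual (N * B)
  rw [h]
  have e : Cᴴ * (N * B) = (Nᴴ * C)ᴴ * B := by
    simp [Matrix.conjTranspose_mul, Matrix.mul_assoc]
  rw [e]
  refine (tr_cs _ _).trans ?_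
  gcongr
  have h1 : fro2 N = fro2 (Nᴴ * C) + fro2 ((1 - C * Cᴴ) * N) := by
    rw [← fro2_eq N, ← fro2_eq' (Nᴴ * C), ← fro2_eq ((1 - C * Cᴴ) * N), ← Complex.add_re,
      ← Matrix.trace_add]
    congr 2
    have e1 : Nᴴ * C * (Nᴴ * C)ᴴ = Nᴴ * (C * Cᴴ) * N := by
      simp [Matrix.conjTranspose_mul, Matrix.mul_assoc]
    have e2 : ((1 - C * Cᴴ) * N)ᴴ * ((1 - C * Cᴴ) * N)
        = Nᴴ * (1 - C * Cᴴ - C * Cᴴ + (C * Cᴴ * C) * Cᴴ) * N := by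
      simp only [Matrix.conjTranspose_mul, Matrix.conjTranspose_sub, Matrix.conjTranspose_one,
        Matrix.conjTranspose_conjTranspose]
      noncomm_ring
    rw [e1, e2, hC]
    noncomm_ring
  rw [h1]
  linarith [fro2_nonneg ((1 - C * Cᴴ) * N)]

lemma fro2_G {d : Type*} [Fintype d] [DecidableEq d] (G F : Matrix d d ℂ) (l : ℝ) (hl : 0 < l)
    (hG : G.PosSemidef) (hG' : ((l : ℂ) • (1 : Matrix d d ℂ) - G).PosSemidef) :
    fro2 (Fᴴ * G) ≤ l * ((Fᴴ * G * F).trace).re := by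
  have h1 : (Fᴴ * (G * ((l : ℂ) • 1 - G) * G) * F).PosSemidef := by
    have := hG'.conjTranspose_mul_mul_same (G * F)
    rw [Matrix.conjTranspose_mul, hG.1.eq] at this
    simpa only [Matrix.mul_assoc] using this
  have h2 : (Fᴴ * (((l : ℂ) • 1 - G) * G * ((l : ℂ) • 1 - G)) * F).PosSemidef := by
    have := hG.conjTranspose_mul_mul_same (((l : ℂ) • 1 - G) * F)
    rw [Matrix.conjTranspose_mul, hG'.1.eq] at this
    simpa only [Matrix.mul_assoc] using this
  have h3 := (Complex.le_def.1 (h1.add h2).trace_nonneg).1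
  have e : Fᴴ * (G * ((l : ℂ) • 1 - G) * G) * F +
     Fᴴ * (((l : ℂ) • 1 - G) * G * ((l : ℂ) • 1 - G)) * F
      = (l : ℂ) • ((l : ℂ) • (Fᴴ * G * F) - (Fᴴ * G) * (Fᴴ * G)ᴴ) := by
    simp only [Matrix.conjTranspose_mul, Matrix.conjTranspose_conjTranspose, hG.1.eq,
      Matrix.mul_sub, Matrix.sub_mul, Matrix.smul_mul, Matrix.mul_smul, Matrix.mul_one,
      Matrix.one_mul, smul_sub, Matrix.mul_assoc]
    abel
  rw [e, Matrix.trace_smul, Matrix.trace_sub, Matrix.trace_smul, smul_eq_mul, smul_eq_mul,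
    Complex.re_ofReal_mul, Complex.sub_re, Complex.re_ofReal_mul, fro2_eq'] at h3
  have := nonneg_of_mul_nonneg_right (by simpa using h3) hl
  linarith

lemma factor {d : Type*} [Fintype d] [DecidableEq d] (ρ F Fi : Matrix d d ℂ) (l : ℝ) (hl : 0 < l)
    (hF : F * Fi = 1) (hρ : ρ.PosSemidef) (h : ((l : ℂ) • (Fᴴ * F) - ρ).PosSemidef) :
    fro2 (ρ * Fi) ≤ l * ρ.trace.re := by
  have hF2 : Fi * F = 1 := mul_eq_one_comm.1 hF
  have hF3 : Fiᴴ * Fᴴ = 1 := by rw [← Matrix.conjTranspose_mul, hF]; simp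
  have hF4 : Fᴴ * Fiᴴ = 1 := by rw [← Matrix.conjTranspose_mul, hF2]; simp
  have h1 := hρ.conjTranspose_mul_mul_same Fi
  have h2 := h.conjTranspose_mul_mul_same Fi
  have e2 : Fiᴴ * ((l : ℂ) • (Fᴴ * F) - ρ) * Fi = (l : ℂ) • 1 - Fiᴴ * ρ * Fi := by
    rw [Matrix.mul_sub, Matrix.sub_mul, Matrix.mul_smul, Matrix.smul_mul]
    congr 2
    calc _ = (Fiᴴ * Fᴴ) * (F * Fi) := by noncomm_ring
      _ = 1 := by rw [hF, hF3]; simp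
  rw [e2] at h2
  have := fro2_G _ F l hl h1 h2
  have e3 : Fᴴ * (Fiᴴ * ρ * Fi) = ρ * Fi := by
    calc _ = (Fᴴ * Fiᴴ) * ρ * Fi := by noncomm_ring
      _ = _ := by rw [hF4]; simp
  rw [e3, Matrix.mul_assoc, hF2, Matrix.mul_one] at this
  exact this

/-! Fourier analysis -/

lemma signZ_add (a b : ZMod 2) : signZ (a + b) = signZ a * signZ b := by
  revert a b; unfold signZ
  have : ∀ a : ZMod 2, a = 0 ∨ a = 1 := by decide
  intro a b
  have h11 : (1 : ZMod 2) + 1 = 0 := by decide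
  rcases this a with rfl | rfl <;> rcases this b with rfl | rfl <;> simp [h11]

lemma signZ_pow (z : ZMod 2) : (-1 : ℂ) ^ z.val = (signZ z : ℂ) := by
  have : ∀ a : ZMod 2, a = 0 ∨ a = 1 := by decide
  rcases this z with rfl | rfl
  · simp [signZ]
  · simp [signZ, ZMod.val_one]

lemma signZ_sq (z : ZMod 2) : signZ z * signZ z = 1 := by
  unfold signZ; split_ifs <;> norm_num

lemma vadd_self {n : ℕ} (x : Fin n → ZMod 2) : x + x = 0 := by
  have : ∀ a : ZMod 2, a + a = 0 := by decide
  ext j; simp [this]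

def chi {n : ℕ} (w x : Fin n → ZMod 2) : ℝ := signZ (∑ j, w j * x j)

lemma chi_add {n : ℕ} (w x y : Fin n → ZMod 2) : chi w (x + y) = chi w x * chi w y := by
  unfold chi; rw [← signZ_add]; simp [mul_add, Finset.sum_add_distrib]

lemma chi_comm {n : ℕ} (w x : Fin n → ZMod 2) : chi w x = chi x w := by
  unfold chi; simp [mul_comm]

lemma chi_sq {n : ℕ} (w x : Fin n → ZMod 2) : chi w x * chi w x = 1 := signZ_sq _

lemma chi_zero {n : ℕ} (w : Fin n → ZMod 2) : chi w 0 = 1 := by simp [chi, signZ]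

lemma sum_chi {n : ℕ} (x : Fin n → ZMod 2) : ∑ w, chi w x = if x = 0 then (2 : ℝ) ^ n else 0 := by
  split_ifs with h
  · subst h; simp [chi_zero, ZMod.card]
  · obtain ⟨j, hj⟩ := Function.ne_iff.1 h
    have hj1 : x j = 1 := by
      have : ∀ a : ZMod 2, a ≠ 0 → a = 1 := by decide
      exact this _ hj
    have h0 : ∀ u : Fin n → ZMod 2, ∑ w, chi w x = ∑ w, chi (w + u) x := fun u =>
      (Equiv.sum_comp (Equiv.addRight u) (fun w => chi w x)).symm
    have h1 := h0 (Pi.single j 1)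
    have h2 : ∀ w, chi (w + Pi.single j 1) x = - chi w x := by
      intro w
      rw [chi_comm, chi_add, chi_comm]
      have : chi x (Pi.single j 1) = -1 := by
        simp [chi, Pi.single_apply, hj1, signZ]
      rw [this]; ring
    simp only [h2, Finset.sum_neg_distrib] at h1
    linarith

def ft {n : ℕ} (g : (Fin n → ZMod 2) → ℂ) (w : Fin n → ZMod 2) : ℂ := ∑ x, (chi w x : ℂ) * g x

lemma parseval {n : ℕ} (g : (Fin n → ZMod 2) → ℂ) :
    ∑ w, ‖ft g w‖ ^ 2 = (2 : ℝ) ^ n * ∑ x, ‖g x‖ ^ 2 := by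
  have h : ((∑ w, ‖ft g w‖ ^ 2 : ℝ) : ℂ) = (((2 : ℝ) ^ n * ∑ x, ‖g x‖ ^ 2 : ℝ) : ℂ) := by
    push_cast
    simp only [← Complex.mul_conj', ft, map_sum, map_mul, Complex.conj_ofReal,
      Finset.sum_mul_sum]
    rw [Finset.sum_comm, Finset.mul_sum]
    refine Finset.sum_congr rfl fun x _ => ?_
    rw [Finset.sum_comm]
    have : ∀ y, ∑ w, (chi w x : ℂ) * g x * ((chi w y : ℂ) * (starRingEnd ℂ) (g y))
        = (if x = y then (2 : ℂ) ^ n else 0) * (g x * (starRingEnd ℂ) (g y)) := by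
      intro y
      have h1 : (∑ w, (chi w (x + y) : ℂ)) = if x = y then (2 : ℂ) ^ n else 0 := by
        have h2 := sum_chi (x + y)
        have h3 : x + y = 0 ↔ x = y := by
          constructor
          · intro h; 
            calc x = x + (y + y) := by rw [vadd_self]; simp
              _ = (x + y) + y := by abel
              _ = y := by rw [h]; simp
          · rintro rfl; exact vadd_self x
        rw [if_congr h3 rfl rfl] at h2
        rw [← Complex.ofReal_sum, h2]; split_ifs <;> simp
      rw [← h1, Finset.sum_mul]
      refine Finset.sum_congr rfl fun w _ => ?_
      rw [chi_add]; push_cast; ring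
    simp only [this, ite_mul, zero_mul, Finset.sum_ite_eq, Finset.mem_univ, if_true]
  exact_mod_cast h

lemma core {n : ℕ} (δ : ℝ) (S : Finset ((Fin n → ZMod 2) × (Fin n → ZMod 2)))
    (hS : S.Nonempty) (hb : DeltaBiased δ S) (hδ : 0 ≤ δ) (z : Fin n → ZMod 2)
    (g : (Fin n → ZMod 2) → ℂ) :
    ∑ x, ‖(S.card : ℂ)⁻¹ * ∑ s ∈ S, (chi s.2 z : ℂ) * g (x + s.1)
      - (if z = 0 then ((2 : ℂ) ^ n)⁻¹ * ∑ y, g y else 0)‖ ^ 2 ≤ δ ^ 2 * ∑ x, ‖g x‖ ^ 2 := by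
  set h : (Fin n → ZMod 2) → ℂ := fun x => (S.card : ℂ)⁻¹ * ∑ s ∈ S, (chi s.2 z : ℂ) * g (x + s.1)
      - (if z = 0 then ((2 : ℂ) ^ n)⁻¹ * ∑ y, g y else 0) with hh
  have hft : ∀ w, ft h w = (((S.card : ℝ)⁻¹ * ∑ s ∈ S, chi s.1 w * chi s.2 z : ℝ) : ℂ) * ft g w
      - (if z = 0 then if w = 0 then ∑ y, g y else 0 else 0) := by
    intro w
    have e1 : ∀ a, ∑ x, (chi w x : ℂ) * g (x + a) = (chi a w : ℂ) * ft g w := by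
      intro a
      unfold ft
      rw [← Equiv.sum_comp (Equiv.addRight a) (fun x => (chi w x : ℂ) * g x), Finset.mul_sum]
      refine Finset.sum_congr rfl fun x _ => ?_
      simp only [Equiv.coe_addRight]
      rw [chi_add, chi_comm a w]
      have : ((chi w a : ℝ) : ℂ) * (chi w a : ℂ) = 1 := by exact_mod_cast chi_sq w a
      push_cast
      linear_combination (-(chi w x : ℂ) * g (x + a)) * this
    have e2 : ∑ x, (chi w x : ℂ) = if w = 0 then (2 : ℂ) ^ n else 0 := by
      have := sum_chi w
      rw [← Complex.ofReal_sum, Finset.sum_congr rfl (fun x _ => chi_comm w x), this]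
      split_ifs <;> simp
    have : ft h w = (S.card : ℂ)⁻¹ * ∑ s ∈ S, (chi s.2 z : ℂ) * ∑ x, (chi w x : ℂ) * g (x + s.1)
        - (∑ x, (chi w x : ℂ)) * (if z = 0 then ((2 : ℂ) ^ n)⁻¹ * ∑ y, g y else 0) := by
      simp only [ft, hh, mul_sub, Finset.sum_sub_distrib, Finset.sum_mul]
      congr 1
      simp only [Finset.mul_sum]
      rw [Finset.sum_comm]
      refine Finset.sum_congr rfl fun s _ => Finset.sum_congr rfl fun x _ => ?_
      ring
    rw [this, e2]
    simp only [e1]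
    congr 1
    · push_cast
      rw [mul_assoc, Finset.sum_mul]
      congr 1
      refine Finset.sum_congr rfl fun s _ => by ring
    · split_ifs <;> simp
  have hbd : ∀ w, ‖ft h w‖ ^ 2 ≤ δ ^ 2 * ‖ft g w‖ ^ 2 := by
    intro w
    rw [hft w]
    by_cases hw : (w, z) = 0
    · obtain ⟨rfl, rfl⟩ := Prod.mk_eq_zero.1 hw
      have hc : (S.card : ℂ) ≠ 0 := by exact_mod_cast hS.card_pos.ne'
      have : ft g 0 = ∑ y, g y := by
        unfold ft; refine Finset.sum_congr rfl fun x _ => ?_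
        rw [chi_comm, chi_zero]; simp
      simp only [chi_zero, if_true, this]
      simp [hc]
      positivity
    · have h1 := hb (w, z) hw
      have h2 : (if z = 0 then if w = 0 then ∑ y, g y else 0 else 0) = 0 := by
        split_ifs with a b
        · exact absurd (by rw [a, b]; rfl) hw
        · rfl
        · rfl
      rw [h2, sub_zero, norm_mul, mul_pow]
      gcongr
      rw [Complex.norm_real, Real.norm_eq_abs]
      simpa only [signZ_add, chi] using h1
  have hsum := Finset.sum_le_sum (fun w (_ : w ∈ Finset.univ) => hbd w)
  rw [← Finset.mul_sum, parseval, parseval] at hsum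
  have h2n : (0 : ℝ) < 2 ^ n := by positivity
  refine le_of_mul_le_mul_left ?_ h2n
  linarith

/-! The channel -/

def Phi {n : ℕ} {E : Type*} [Fintype E] [DecidableEq E]
    (S : Finset ((Fin n → ZMod 2) × (Fin n → ZMod 2)))
    (ρ : Matrix ((Fin n → ZMod 2) × E) ((Fin n → ZMod 2) × E) ℂ) :
    Matrix ((Fin n → ZMod 2) × E) ((Fin n → ZMod 2) × E) ℂ :=
  ASCipher S ρ -
        ((2 : ℂ) ^ n)⁻¹ •
          ((1 : Matrix (Fin n → ZMod 2) (Fin n → ZMod 2) ℂ) ⊗ₖ ptraceA ρ)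

lemma Phi_mul {n : ℕ} {E : Type*} [Fintype E] [DecidableEq E]
    (S : Finset ((Fin n → ZMod 2) × (Fin n → ZMod 2)))
    (M : Matrix ((Fin n → ZMod 2) × E) ((Fin n → ZMod 2) × E) ℂ) (B : Matrix E E ℂ) :
    Phi S (M * ((1 : Matrix (Fin n → ZMod 2) (Fin n → ZMod 2) ℂ) ⊗ₖ B))
      = Phi S M * ((1 : Matrix (Fin n → ZMod 2) (Fin n → ZMod 2) ℂ) ⊗ₖ B) := by
  have hp : ptraceA (M * ((1 : Matrix (Fin n → ZMod 2) (Fin n → ZMod 2) ℂ) ⊗ₖ B))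
      = ptraceA M * B := by
    ext e f
    simp only [ptraceA, Matrix.of_apply, Matrix.mul_apply, Matrix.kroneckerMap_apply,
      Fintype.sum_prod_type, Matrix.one_apply, Finset.sum_mul]
    rw [Finset.sum_comm (s := Finset.univ (α := E))]
    refine Finset.sum_congr rfl fun a _ => ?_
    rw [Finset.sum_comm]
    refine Finset.sum_congr rfl fun x _ => ?_
    simp [ite_mul, mul_ite]
  have hs : ∀ P : Matrix (Fin n → ZMod 2) (Fin n → ZMod 2) ℂ,
      (P ⊗ₖ (1 : Matrix E E ℂ)) * (M * ((1 : Matrix (Fin n → ZMod 2) (Fin n → ZMod 2) ℂ) ⊗ₖ B)) *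
        (P ⊗ₖ (1 : Matrix E E ℂ))ᴴ = (P ⊗ₖ (1 : Matrix E E ℂ)) * M * (P ⊗ₖ (1 : Matrix E E ℂ))ᴴ *
        ((1 : Matrix (Fin n → ZMod 2) (Fin n → ZMod 2) ℂ) ⊗ₖ B) := by
    intro P
    have hc : ((1 : Matrix (Fin n → ZMod 2) (Fin n → ZMod 2) ℂ) ⊗ₖ B) *
        (P ⊗ₖ (1 : Matrix E E ℂ))ᴴ = (P ⊗ₖ (1 : Matrix E E ℂ))ᴴ *
        ((1 : Matrix (Fin n → ZMod 2) (Fin n → ZMod 2) ℂ) ⊗ₖ B) := by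
      rw [Matrix.conjTranspose_kronecker, Matrix.conjTranspose_one, ← Matrix.mul_kronecker_mul,
        ← Matrix.mul_kronecker_mul]
      simp only [Matrix.mul_one, Matrix.one_mul]
    simp only [Matrix.mul_assoc, hc]
  have hk : (1 : Matrix (Fin n → ZMod 2) (Fin n → ZMod 2) ℂ) ⊗ₖ (ptraceA M * B) =
      ((1 : Matrix (Fin n → ZMod 2) (Fin n → ZMod 2) ℂ) ⊗ₖ ptraceA M) *
      ((1 : Matrix (Fin n → ZMod 2) (Fin n → ZMod 2) ℂ) ⊗ₖ B) := by
    rw [← Matrix.mul_kronecker_mul, Matrix.mul_one]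
  unfold Phi ASCipher
  simp only [hp, hs, hk, Matrix.sub_mul, Matrix.smul_mul, Matrix.sum_mul]

lemma conj_entry {n : ℕ} {E : Type*} [Fintype E] [DecidableEq E]
    (M : Matrix ((Fin n → ZMod 2) × E) ((Fin n → ZMod 2) × E) ℂ) (u v x y : Fin n → ZMod 2)
    (e f : E) :
    ((pauliXZ n u v ⊗ₖ (1 : Matrix E E ℂ)) * M *
      (pauliXZ n u v ⊗ₖ (1 : Matrix E E ℂ))ᴴ) (x, e) (y, f)
      = (chi v (x + y) : ℂ) * M (x + u, e) (y + u, f) := by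
  have hx : ∀ x y : Fin n → ZMod 2, x = y + u ↔ y = x + u := by
    intro x y
    constructor
    · rintro rfl; rw [add_assoc, vadd_self, add_zero]
    · rintro rfl; rw [add_assoc, vadd_self, add_zero]
  have hP : ∀ x y, pauliXZ n u v x y = if y = x + u then (chi v y : ℂ) else 0 := by
    intro x y
    simp only [pauliXZ, Matrix.of_apply, signZ_pow, hx x y]
    rfl
  simp only [Matrix.mul_apply, Matrix.conjTranspose_apply, Matrix.kroneckerMap_apply,
      Fintype.sum_prod_type, Matrix.one_apply, hP]
  simp only [mul_ite, mul_one, mul_zero, ite_mul, zero_mul, Finset.sum_ite_eq, Finset.mem_univ,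
    if_true, apply_ite star, star_zero, Finset.sum_const_zero, Finset.sum_ite_irrel]
  simp only [Finset.sum_ite_eq', Finset.sum_ite_eq, Finset.mem_univ, if_true]
  have h1 : chi v (x + y) = chi v (x + u) * chi v (y + u) := by
    rw [chi_add, chi_add, chi_add]
    linear_combination (-chi v x * chi v y) * chi_sq v u
  rw [h1]; simp; ring

lemma Phi_fro {n : ℕ} {E : Type*} [Fintype E] [DecidableEq E] (δ : ℝ)
    (S : Finset ((Fin n → ZMod 2) × (Fin n → ZMod 2)))
    (hS : S.Nonempty) (hb : DeltaBiased δ S) (hδ : 0 ≤ δ)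
    (M : Matrix ((Fin n → ZMod 2) × E) ((Fin n → ZMod 2) × E) ℂ) :
    fro2 (Phi S M) ≤ δ ^ 2 * fro2 M := by
  have re : ∀ X : Matrix ((Fin n → ZMod 2) × E) ((Fin n → ZMod 2) × E) ℂ,
      fro2 X = ∑ e, ∑ f, ∑ z, ∑ x, ‖X (x, e) (x + z, f)‖ ^ 2 := by
    intro X
    simp only [fro2, Fintype.sum_prod_type]
    rw [Finset.sum_comm]
    refine Finset.sum_congr rfl fun e _ => ?_
    have : ∀ x, ∑ y, ∑ f, ‖X (x, e) (y, f)‖ ^ 2 = ∑ f, ∑ z, ‖X (x, e) (x + z, f)‖ ^ 2 := by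
      intro x
      rw [Finset.sum_comm]
      refine Finset.sum_congr rfl fun f _ => ?_
      exact (Equiv.sum_comp (Equiv.addLeft x) (fun y => ‖X (x, e) (y, f)‖ ^ 2)).symm
    simp only [this]
    rw [Finset.sum_comm]
    refine Finset.sum_congr rfl fun f _ => ?_
    rw [Finset.sum_comm]
  rw [re, re]
  simp only [Finset.mul_sum (s := Finset.univ (α := E)),
    Finset.mul_sum (s := Finset.univ (α := Fin n → ZMod 2)) (f := fun z => ∑ x, _)]
  refine Finset.sum_le_sum fun e _ => Finset.sum_le_sum fun f _ => Finset.sum_le_sum fun z _ => ?_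
  refine le_trans (le_of_eq ?_) (core δ S hS hb hδ z (fun x => M (x, e) (x + z, f)))
  refine Finset.sum_congr rfl fun x _ => ?_
  congr 2
  unfold Phi ASCipher
  rw [Matrix.sub_apply, Matrix.smul_apply, Matrix.smul_apply, Matrix.sum_apply]
  simp only [conj_entry, smul_eq_mul, Matrix.kroneckerMap_apply, Matrix.one_apply, ptraceA,
    Matrix.of_apply]
  congr 1
  · congr 1
    refine Finset.sum_congr rfl fun s _ => ?_
    have h1 : x + (x + z) = z := by rw [← add_assoc, vadd_self, zero_add]
    have h2 : x + z + s.1 = x + s.1 + z := by abel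
    rw [h1, h2]
  · by_cases hz : z = 0
    · subst hz; simp
    · simp [hz]

lemma fro2_one_kron {A E : Type*} [Fintype A] [DecidableEq A] [Fintype E] [DecidableEq E]
    (B : Matrix E E ℂ) :
    fro2 ((1 : Matrix A A ℂ) ⊗ₖ B) = Fintype.card A * ((Bᴴ * B).trace).re := by
  rw [← fro2_eq, Matrix.conjTranspose_kronecker, ← Matrix.mul_kronecker_mul,
    Matrix.trace_kronecker]
  simp

open scoped MatrixOrder in
lemma psd_factor {d : Type*} [Fintype d] [DecidableEq d] {A : Matrix d d ℂ} (hA : A.PosSemidef) :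
    ∃ B : Matrix d d ℂ, A = Bᴴ * B := by
  obtain ⟨a, ha⟩ := CStarAlgebra.nonneg_iff_eq_star_mul_self.mp hA.nonneg
  exact ⟨a, ha⟩

/-- for a `δ`-biased set `S` and any density matrix `ρ` with
conditional min-entropy at least `t` (witnessed by `ρ ≤ 2^{-t}(I ⊗ σ)`), the
Ambainis–Smith cipher satisfies
`‖E(ρ) - (I/2^n) ⊗ tr_A ρ‖₁ ≤ δ √(2^n 2^{-t})`. -/
theorem ambainis_smith_security {n dE : ℕ} (hn : 1 ≤ n) (δ : ℝ) (hδ : 0 ≤ δ)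
    (S : Finset ((Fin n → ZMod 2) × (Fin n → ZMod 2)))
    (hS : S.Nonempty) (hbias : DeltaBiased δ S) (t : ℝ)
    (ρ : Matrix ((Fin n → ZMod 2) × Fin dE) ((Fin n → ZMod 2) × Fin dE) ℂ)
    (hρ : IsDensity ρ)
    (hmin : ∃ σ : Matrix (Fin dE) (Fin dE) ℂ, IsDensity σ ∧
      LoewnerLE ρ ((((2 : ℝ) ^ (-t) : ℝ) : ℂ) •
        ((1 : Matrix (Fin n → ZMod 2) (Fin n → ZMod 2) ℂ) ⊗ₖ σ))) :
    traceNorm (ASCipher S ρ -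
        ((2 : ℂ) ^ n)⁻¹ •
          ((1 : Matrix (Fin n → ZMod 2) (Fin n → ZMod 2) ℂ) ⊗ₖ ptraceA ρ))
      ≤ δ * Real.sqrt ((2 : ℝ) ^ n * (2 : ℝ) ^ (-t)) := by
  obtain ⟨σ, hσ, hle⟩ := hmin
  set l : ℝ := (2 : ℝ) ^ (-t) with hldef
  have hl : 0 < l := by positivity
  have main : ∀ ε : ℝ, 0 < ε → traceNorm (Phi S ρ) ≤ (δ * √l) * √((2 : ℝ) ^ n * (1 + ε * dE)) := by
    intro ε hε
    have hpos1 : ((ε : ℂ) • (1 : Matrix (Fin dE) (Fin dE) ℂ)).PosDef :=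
      Matrix.PosDef.one.smul (by exact_mod_cast hε)
    have hpos : (σ + (ε : ℂ) • (1 : Matrix (Fin dE) (Fin dE) ℂ)).PosDef :=
      Matrix.PosDef.posSemidef_add hσ.1 hpos1
    obtain ⟨B, hB⟩ := psd_factor hpos.posSemidef
    have hBu : IsUnit B := by
      have := hpos.isUnit
      rw [hB] at this
      rw [Matrix.isUnit_iff_isUnit_det] at this ⊢
      rw [Matrix.det_mul] at this
      exact isUnit_of_mul_isUnit_right this
    have hBB : B * B⁻¹ = 1 := Matrix.mul_nonsing_inv _ ((Matrix.isUnit_iff_isUnit_det _).1 hBu)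
    have hBB' : B⁻¹ * B = 1 := Matrix.nonsing_inv_mul _ ((Matrix.isUnit_iff_isUnit_det _).1 hBu)
    set F := (1 : Matrix (Fin n → ZMod 2) (Fin n → ZMod 2) ℂ) ⊗ₖ B with hF
    set Fi := (1 : Matrix (Fin n → ZMod 2) (Fin n → ZMod 2) ℂ) ⊗ₖ B⁻¹ with hFi
    have hFF : F * Fi = 1 := by
      rw [hF, hFi, ← Matrix.mul_kronecker_mul, hBB, Matrix.mul_one, Matrix.one_kronecker_one]
    have hFF' : Fi * F = 1 := mul_eq_one_comm.1 hFF
    have hFHF : Fᴴ * F = (1 : Matrix (Fin n → ZMod 2) (Fin n → ZMod 2) ℂ) ⊗ₖ σ + (ε : ℂ) • 1 := by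
      rw [hF, Matrix.conjTranspose_kronecker, ← Matrix.mul_kronecker_mul, ← hB,
        Matrix.conjTranspose_one, Matrix.mul_one, Matrix.kronecker_add, Matrix.kronecker_smul,
        Matrix.one_kronecker_one]
    have hle2 : ((l : ℂ) • (Fᴴ * F) - ρ).PosSemidef := by
      have h1 : ((((l * ε : ℝ)) : ℂ) • (1 : Matrix ((Fin n → ZMod 2) × Fin dE)
          ((Fin n → ZMod 2) × Fin dE) ℂ)).PosSemidef :=
        Matrix.PosSemidef.one.smul (by exact_mod_cast (mul_pos hl hε).le)
      have h2 := Matrix.PosSemidef.add hle h1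
      convert h2 using 1
      rw [hFHF, smul_add, smul_smul]
      push_cast
      abel
    have hM := factor ρ F Fi l hl hFF hρ.1 hle2
    rw [hρ.2] at hM
    have hdec : Phi S ρ = Phi S (ρ * Fi) * F := by
      rw [hF, ← Phi_mul, ← hF, Matrix.mul_assoc, hFF', Matrix.mul_one]
    rw [hdec]
    refine (traceNorm_mul_le _ _).trans ?_
    have hf : fro2 F = (2 : ℝ) ^ n * (1 + ε * dE) := by
      rw [hF, fro2_one_kron, ← hB, Matrix.trace_add, hσ.2, Matrix.trace_smul, Matrix.trace_one]
      simp [ZMod.card]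
    rw [hf]
    gcongr
    rw [← Real.sqrt_sq hδ, ← Real.sqrt_mul (sq_nonneg δ)]
    apply Real.sqrt_le_sqrt
    refine (Phi_fro δ S hS hbias hδ _).trans ?_
    gcongr
    simpa using hM
  have hlim : Filter.Tendsto (fun ε : ℝ => (δ * √l) * √((2 : ℝ) ^ n * (1 + ε * dE)))
      (nhdsWithin 0 (Set.Ioi 0)) (nhds ((δ * √l) * √((2 : ℝ) ^ n * (1 + 0 * dE)))) := by
    have : Continuous (fun ε : ℝ => (δ * √l) * √((2 : ℝ) ^ n * (1 + ε * dE))) := by fun_prop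
    exact (this.tendsto 0).mono_left nhdsWithin_le_nhds
  have hfin := ge_of_tendsto hlim (Filter.eventually_of_mem self_mem_nhdsWithin
    (fun ε hε => main ε hε))
  refine hfin.trans (le_of_eq ?_)
  rw [zero_mul, add_zero, mul_one, mul_assoc, ← Real.sqrt_mul hl.le, mul_comm l]
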